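/- For every open MDP 𝒜, every entrance i of 𝒜, and every sound approximation (L,U) of 𝒜: A^{D(L)}(i) ⊆ A^𝒜(i) ⊆ A^{D(U)}(i), where D(L) and D(U) are the shortcut oMDPs of the families L and U. -/

import Mathlib

open scoped Classical ENNReal

namespace SD

/-- A Markov decision process with finite sets of states and actions: a partial
transition function assigning to a state and an action a probability
distribution over states. -/
structure MDP (S A : Type) : Type where
  P : S → A → Option (S → ℝ)

namespace MDP

variable {S A : Type} [Fintype S] [Fintype A]

/-- All defined transitions are genuine probability distributions. -/
def Proper (M : MDP S A) : Prop :=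
  ∀ s a d, M.P s a = some d → (∀ s', 0 ≤ d s') ∧ ∑ s', d s' = 1

/-- The action `a` is enabled in `s`. -/
def enabled (M : MDP S A) (s : S) (a : A) : Prop := M.P s a ≠ none

/-- A state is terminal if no action is enabled in it. -/
def terminal (M : MDP S A) (s : S) : Prop := ∀ a, M.P s a = none

/-- Transition probabilities. -/
noncomputable def prob (M : MDP S A) (s : S) (a : A) (s' : S) : ℝ :=
  (M.P s a).elim 0 fun d => d s'

end MDP

/-- A finite path of an MDP: a start state with a list of (action, next state) steps. -/
structure FinPath (S A : Type) : Type where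
  start : S
  steps : List (A × S)

namespace FinPath

/-- The last state of a finite path. -/
def last {S A : Type} (π : FinPath S A) : S := (π.steps.map Prod.snd).getLastD π.start

/-- Extending a finite path by one step. -/
def snoc {S A : Type} (π : FinPath S A) (a : A) (s : S) : FinPath S A :=
  ⟨π.start, π.steps ++ [(a, s)]⟩

end FinPath

namespace MDP

variable {S A : Type} [Fintype S] [Fintype A]

/-- Consistency of a sequence of steps with the transitions, from a given state. -/
def ConsistentFrom (M : MDP S A) : S → List (A × S) → Prop
  | _, [] => True
  | s, (a, s') :: l => M.prob s a s' ≠ 0 ∧ ConsistentFrom M s' l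

/-- A finite path is consistent if every step has nonzero probability. -/
def Consistent (M : MDP S A) (π : FinPath S A) : Prop := M.ConsistentFrom π.start π.steps

end MDP

/-- A (history-dependent, stochastic) scheduler, given by its raw weights. -/
abbrev Sched (S A : Type) : Type := FinPath S A → A → ℝ

namespace MDP

variable {S A : Type} [Fintype S] [Fintype A]

/-- `σ` is a scheduler for `M`: it assigns to every (consistent) finite path a
probability distribution over the actions enabled in its last state. -/
def IsSched (M : MDP S A) (σ : Sched S A) : Prop :=
  ∀ π : FinPath S A, M.Consistent π →
    (∀ a, 0 ≤ σ π a) ∧ (∀ a, σ π a ≠ 0 → M.enabled π.last a) ∧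
      (¬M.terminal π.last → ∑ a, σ π a = 1)

end MDP

/-- Memoryless schedulers depend only on the last state of a path. -/
def Memoryless {S A : Type} (σ : Sched S A) : Prop :=
  ∀ π π' : FinPath S A, π.last = π'.last → σ π = σ π'

/-- Deterministic schedulers choose Dirac distributions. -/
def Deterministic {S A : Type} (σ : Sched S A) : Prop := ∀ π a, σ π a = 0 ∨ σ π a = 1

/-- Deterministic memoryless (DM) schedulers. -/
def DM {S A : Type} (σ : Sched S A) : Prop := Memoryless σ ∧ Deterministic σ

namespace MDP

variable {S A : Type} [Fintype S] [Fintype A]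

/-- Probability of visiting `T` within `n` steps (terminal states made absorbing),
starting from the history `π`, under the scheduler `σ`. -/
noncomputable def reachN (M : MDP S A) (σ : Sched S A) (T : Set S) :
    ℕ → FinPath S A → ℝ
  | 0, π => if π.last ∈ T then 1 else 0
  | n + 1, π =>
      if π.last ∈ T then 1
      else ∑ a : A, σ π a * ∑ s' : S, M.prob π.last a s' * reachN M σ T n (π.snoc a s')

/-- `Pr^{M,σ}(s ⊨ ◇T)`: the probability, under the measure on infinite paths induced
by `σ` from `s` (terminal states made absorbing), of the paths that visit `T`; it is
the supremum of the bounded-horizon reachability probabilities. -/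
noncomputable def Pr (M : MDP S A) (σ : Sched S A) (s : S) (T : Set S) : ℝ :=
  ⨆ n : ℕ, M.reachN σ T n ⟨s, []⟩

end MDP

/-- An open MDP: an MDP together with (totally ordered, given as lists) sets of
rightward/leftward entrances and exits. -/
structure OMDP (S A : Type) : Type where
  M : MDP S A
  Ir : List S
  Il : List S
  Or : List S
  Ol : List S

namespace OMDP

variable {S A : Type}

/-- The entrances `I = I_r ∪ I_l`. -/
def entr (𝒜 : OMDP S A) : List S := 𝒜.Ir ++ 𝒜.Il

/-- The exits `O = O_r ∪ O_l`. -/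
def exit (𝒜 : OMDP S A) : List S := 𝒜.Or ++ 𝒜.Ol

/-- The index type of exits. -/
abbrev ExitIdx (𝒜 : OMDP S A) : Type := {s : S // s ∈ 𝒜.exit}

/-- The index type of entrances. -/
abbrev EntrIdx (𝒜 : OMDP S A) : Type := {s : S // s ∈ 𝒜.entr}

variable [Fintype S] [Fintype A]

/-- Well-formedness of an open MDP: the transitions are probability
distributions, the open ends are pairwise disjoint (each without duplicates),
and the exits are exactly the terminal states. -/
def WF (𝒜 : OMDP S A) : Prop :=
  𝒜.M.Proper ∧ (𝒜.Ir ++ 𝒜.Il ++ 𝒜.Or ++ 𝒜.Ol).Nodup ∧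
    ∀ s : S, s ∈ 𝒜.exit ↔ 𝒜.M.terminal s

/-- `Pr^{𝒜,σ}(i ⊨ ◇O) ∈ ℝ^O`: the vector of reachability probabilities to each exit. -/
noncomputable def prVec (𝒜 : OMDP S A) (σ : Sched S A) (i : S) : 𝒜.ExitIdx → ℝ :=
  fun j => 𝒜.M.Pr σ i {j.1}

/-- The set `A^𝒜(i)` of achievable points from `i`. -/
def achievable (𝒜 : OMDP S A) (i : S) : Set (𝒜.ExitIdx → ℝ) :=
  {p | ∃ σ : Sched S A, 𝒜.M.IsSched σ ∧ p ≤ 𝒜.prVec σ i}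

/-- The set `A^{𝒜,Σ}(i)` of points achievable from `i` by schedulers in the class `C`. -/
def achievableBy (𝒜 : OMDP S A) (i : S) (C : Sched S A → Prop) : Set (𝒜.ExitIdx → ℝ) :=
  {p | ∃ σ : Sched S A, 𝒜.M.IsSched σ ∧ C σ ∧ p ≤ 𝒜.prVec σ i}

/-- The Pareto curve `𝒮(𝒜, i)`: achievable points not strictly dominated by an
achievable point. -/
def pareto (𝒜 : OMDP S A) (i : S) : Set (𝒜.ExitIdx → ℝ) :=
  {p | p ∈ 𝒜.achievable i ∧ ∀ q ∈ 𝒜.achievable i, p ≤ q → q = p}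

end OMDP

/-- Downward closure. -/
def dw {ι : Type} (X : Set (ι → ℝ)) : Set (ι → ℝ) := {p | ∃ q ∈ X, p ≤ q}

/-- Downward convex closure. -/
def dwConv {ι : Type} (X : Set (ι → ℝ)) : Set (ι → ℝ) := dw (convexHull ℝ X)

/-- Subdistributions on `ι`: nonnegative points with coordinate sum at most 1. -/
def Subdist {ι : Type} [Fintype ι] (p : ι → ℝ) : Prop :=
  (∀ j, 0 ≤ p j) ∧ ∑ j, p j ≤ 1

end SD

namespace SD

namespace OMDP

variable {S A : Type} [Fintype S] [Fintype A]

/-- The actions of a shortcut oMDP for the family `B`: the union of the `B i`. -/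
abbrev ShortAct (𝒜 : OMDP S A) (B : 𝒜.EntrIdx → Finset (𝒜.ExitIdx → ℝ)) : Type :=
  {p : 𝒜.ExitIdx → ℝ // ∃ i, p ∈ B i}

noncomputable instance instFintypeShortAct (𝒜 : OMDP S A)
    (B : 𝒜.EntrIdx → Finset (𝒜.ExitIdx → ℝ)) : Fintype (ShortAct 𝒜 B) := by
  have h : {p : 𝒜.ExitIdx → ℝ | ∃ i, p ∈ B i}.Finite := by
    have he : {p : 𝒜.ExitIdx → ℝ | ∃ i, p ∈ B i} =
        ⋃ i, ((B i : Finset (𝒜.ExitIdx → ℝ)) : Set (𝒜.ExitIdx → ℝ)) := by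
      ext p; simp
    rw [he]
    exact Set.finite_iUnion fun i => (B i).finite_toSet
  exact h.fintype

/-- The shortcut oMDP `D(B)` of a family `B = (B_i)_{i ∈ I}` of finite sets of
subdistributions on the exits: states are the entrances and exits of `𝒜`
together with a fresh sink `⋆` (encoded by `Option S`, with `⋆ = none`), actions
are the points in the `B_i`, and from entrance `i` the action `p ∈ B_i` moves to
exit `o` with probability `p(o)` and to `⋆` with the remaining probability
`1 - Σ_o p(o)`. -/
noncomputable def shortcut (𝒜 : OMDP S A) (B : 𝒜.EntrIdx → Finset (𝒜.ExitIdx → ℝ)) :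
    OMDP (Option S) (ShortAct 𝒜 B) where
  M := ⟨fun t a =>
    match t with
    | none => none
    | some s =>
        if _h : ∃ hs : s ∈ 𝒜.entr, a.1 ∈ B ⟨s, hs⟩ then
          some fun t' =>
            match t' with
            | none => 1 - ∑ j : 𝒜.ExitIdx, a.1 j
            | some s' => ∑ j : 𝒜.ExitIdx, if j.1 = s' then a.1 j else 0
        else none⟩
  Ir := 𝒜.Ir.map some
  Il := 𝒜.Il.map some
  Or := 𝒜.Or.map some
  Ol := 𝒜.Ol.map some

end OMDP

/-- Transporting points in `ℝ^{O_𝒴}` to points in `ℝ^{O_𝒳}` along a map of exits. -/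
def pullExit {S₁ A₁ S₂ A₂ : Type} (𝒳 : OMDP S₁ A₁) (𝒴 : OMDP S₂ A₂) (f : S₁ → S₂)
    (hf : ∀ s ∈ 𝒳.exit, f s ∈ 𝒴.exit) (p : 𝒴.ExitIdx → ℝ) : 𝒳.ExitIdx → ℝ :=
  fun j => p ⟨f j.1, hf j.1 j.2⟩

end SD

namespace SD

namespace MDP

variable {S A : Type}

theorem last_snoc (π : FinPath S A) (a : A) (s : S) : (π.snoc a s).last = s := by
  simp [FinPath.snoc, FinPath.last, List.getLastD_eq_getLast?]

theorem prob_eq_zero_of_terminal {M : MDP S A} {s : S} (h : M.terminal s) (a : A) (s' : S) :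
    M.prob s a s' = 0 := by
  simp [prob, h a]

theorem prob_nonneg [Fintype S] {M : MDP S A} (hM : M.Proper) (s : S) (a : A) (s' : S) :
    0 ≤ M.prob s a s' := by
  unfold prob
  cases h : M.P s a with
  | none => simp
  | some d => simpa using (hM s a d h).1 s'

theorem reachN_nonneg [Fintype S] [Fintype A] {M : MDP S A} (hM : M.Proper)
    {σ : Sched S A} (hσ : ∀ π a, 0 ≤ σ π a)
    (T : Set S) (n : ℕ) (π : FinPath S A) : 0 ≤ M.reachN σ T n π := by
  induction n generalizing π with
  | zero => unfold reachN; split_ifs <;> norm_num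
  | succ n ih =>
    unfold reachN
    split_ifs
    · norm_num
    · exact Finset.sum_nonneg fun a _ => mul_nonneg (hσ π a) <|
        Finset.sum_nonneg fun s' _ => mul_nonneg (prob_nonneg hM _ _ _) (ih _)

theorem reachN_of_terminal [Fintype S] [Fintype A] {M : MDP S A} (σ : Sched S A) (T : Set S) (n : ℕ)
    {π : FinPath S A} (h : M.terminal π.last) :
    M.reachN σ T n π = if π.last ∈ T then 1 else 0 := by
  cases n with
  | zero => rfl
  | succ n => simp [reachN, prob_eq_zero_of_terminal h]

/-- If every successor of `s` is terminal, reaching `t ≠ s` from `s` takes exactly one step. -/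
theorem Pr_singleton_of_terminal_succ [Fintype S] [Fintype A] {M : MDP S A} {σ : Sched S A}
    {s t : S} (hst : s ≠ t)
    (hsucc : ∀ a s', M.prob s a s' ≠ 0 → M.terminal s')
    (hnn : 0 ≤ ∑ a, σ ⟨s, []⟩ a * M.prob s a t) :
    M.Pr σ s {t} = ∑ a, σ ⟨s, []⟩ a * M.prob s a t := by
  have hlast : FinPath.last (⟨s, []⟩ : FinPath S A) = s := rfl
  have h0 : M.reachN σ {t} 0 ⟨s, []⟩ = 0 := by simp [reachN, hlast, hst]
  have h1 (n : ℕ) : M.reachN σ {t} (n + 1) ⟨s, []⟩ = ∑ a, σ ⟨s, []⟩ a * M.prob s a t := by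
    have hstep (a : A) (s' : S) :
        M.prob s a s' * M.reachN σ {t} n (FinPath.snoc ⟨s, []⟩ a s') =
          if s' = t then M.prob s a s' else 0 := by
      by_cases hp : M.prob s a s' = 0
      · simp [hp]
      · rw [reachN_of_terminal _ _ _ (by rw [last_snoc]; exact hsucc a s' hp), last_snoc]
        simp
    simp [reachN, hlast, hst, hstep]
  have hle (n : ℕ) : M.reachN σ {t} n ⟨s, []⟩ ≤ ∑ a, σ ⟨s, []⟩ a * M.prob s a t := by
    cases n with
    | zero => rw [h0]; exact hnn
    | succ n => exact (h1 n).le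
  refine le_antisymm (ciSup_le hle) ?_
  rw [← h1 0]
  exact le_ciSup (f := fun n => M.reachN σ {t} n ⟨s, []⟩)
    ⟨_, Set.forall_mem_range.2 hle⟩ 1

/-- The scheduler that always picks some fixed enabled action, if there is one. -/
noncomputable def anySched (M : MDP S A) : Sched S A := fun π a =>
  if h : ∃ b, M.enabled π.last b then if a = h.choose then 1 else 0 else 0

theorem anySched_nonneg (M : MDP S A) (π : FinPath S A) (a : A) : 0 ≤ M.anySched π a := by
  unfold anySched
  split_ifs <;> norm_num

theorem isSched_anySched [Fintype S] [Fintype A] (M : MDP S A) : M.IsSched M.anySched := by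
  refine fun π _ => ⟨M.anySched_nonneg π, fun a ha => ?_, fun ht => ?_⟩
  · unfold anySched at ha
    split_ifs at ha with h h'
    · exact h' ▸ h.choose_spec
    · exact absurd rfl ha
    · exact absurd rfl ha
  · have h : ∃ b, M.enabled π.last b := by
      simpa [terminal, enabled] using ht
    simp [anySched, h]

end MDP

namespace OMDP

variable {S A : Type}

theorem zero_mem_achievable [Fintype S] [Fintype A] {𝒜 : OMDP S A} (hM : 𝒜.M.Proper) (i : S) :
    (0 : 𝒜.ExitIdx → ℝ) ∈ 𝒜.achievable i :=
  ⟨𝒜.M.anySched, 𝒜.M.isSched_anySched, fun _ => Real.iSup_nonneg fun n =>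
    MDP.reachN_nonneg hM 𝒜.M.anySched_nonneg _ n _⟩

theorem WF.notMem_entr [Fintype S] {𝒜 : OMDP S A} (h : 𝒜.WF) {s : S} (hs : s ∈ 𝒜.exit) :
    s ∉ 𝒜.entr := by
  have hd : (𝒜.entr ++ 𝒜.exit).Nodup := by
    simpa [entr, exit] using h.2.1
  exact fun he => (List.disjoint_of_nodup_append hd) he hs

section Shortcut

variable (𝒜 : OMDP S A) (B : 𝒜.EntrIdx → Finset (𝒜.ExitIdx → ℝ))

theorem shortcut_enabled_iff (i : 𝒜.EntrIdx) (a : ShortAct 𝒜 B) :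
    (𝒜.shortcut B).M.enabled (some i.1) a ↔ a.1 ∈ B i := by
  have := i.2
  simp [MDP.enabled, shortcut, this]

theorem shortcut_terminal_none : (𝒜.shortcut B).M.terminal none := fun _ => rfl

theorem shortcut_terminal_some {s : S} (hs : s ∉ 𝒜.entr) :
    (𝒜.shortcut B).M.terminal (some s) := fun a => by
  simp [shortcut, hs]

theorem shortcut_prob_some (i : 𝒜.EntrIdx) {a : ShortAct 𝒜 B} (ha : a.1 ∈ B i) (s : S) :
    (𝒜.shortcut B).M.prob (some i.1) a (some s) =
      ∑ j : 𝒜.ExitIdx, if j.1 = s then a.1 j else 0 := by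
  have := i.2
  simp [MDP.prob, shortcut, this, ha]

theorem shortcut_prob_exit (i : 𝒜.EntrIdx) {a : ShortAct 𝒜 B} (ha : a.1 ∈ B i)
    (o : 𝒜.ExitIdx) : (𝒜.shortcut B).M.prob (some i.1) a (some o.1) = a.1 o := by
  rw [shortcut_prob_some 𝒜 B i ha]
  simp [Subtype.coe_inj]

theorem shortcut_prob_of_notMem (i : 𝒜.EntrIdx) {a : ShortAct 𝒜 B} (ha : a.1 ∉ B i)
    (t : Option S) : (𝒜.shortcut B).M.prob (some i.1) a t = 0 := by
  have h : (𝒜.shortcut B).M.P (some i.1) a = none := by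
    simpa [MDP.enabled] using (shortcut_enabled_iff 𝒜 B i a).not.2 ha
  simp [MDP.prob, h]

variable {𝒜 B}

theorem shortcut_terminal_succ [Fintype S] (hWF : 𝒜.WF) (i : 𝒜.EntrIdx) (a : ShortAct 𝒜 B)
    (t : Option S)
    (h : (𝒜.shortcut B).M.prob (some i.1) a t ≠ 0) : (𝒜.shortcut B).M.terminal t := by
  cases t with
  | none => exact shortcut_terminal_none 𝒜 B
  | some s =>
    by_cases ha : a.1 ∈ B i
    · rw [shortcut_prob_some 𝒜 B i ha] at h
      obtain ⟨j, -, hj⟩ := Finset.exists_ne_zero_of_sum_ne_zero h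
      have hjs : j.1 = s := by
        by_contra hne
        simp [hne] at hj
      exact shortcut_terminal_some 𝒜 B (hjs ▸ hWF.notMem_entr j.2)
    · exact absurd (shortcut_prob_of_notMem 𝒜 B i ha _) h

/-- From an entrance of a shortcut oMDP, the exits are reached with the mixture of the
points of the family that the scheduler selects. -/
theorem shortcut_Pr [Fintype S] [Fintype A] (hWF : 𝒜.WF) (hB : ∀ k, ∀ p ∈ B k, Subdist p)
    (i : 𝒜.EntrIdx)
    {σ : Sched (Option S) (ShortAct 𝒜 B)} (hnn : ∀ a, 0 ≤ σ ⟨some i.1, []⟩ a)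
    (hsupp : ∀ a, σ ⟨some i.1, []⟩ a ≠ 0 → a.1 ∈ B i) (o : 𝒜.ExitIdx) :
    (𝒜.shortcut B).M.Pr σ (some i.1) {some o.1} = ∑ a, σ ⟨some i.1, []⟩ a * a.1 o := by
  have hterm (a : ShortAct 𝒜 B) :
      σ ⟨some i.1, []⟩ a * (𝒜.shortcut B).M.prob (some i.1) a (some o.1) =
        σ ⟨some i.1, []⟩ a * a.1 o := by
    by_cases h : σ ⟨some i.1, []⟩ a = 0
    · simp [h]
    · rw [shortcut_prob_exit 𝒜 B i (hsupp a h)]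
  have hne : some i.1 ≠ some o.1 := fun h =>
    hWF.notMem_entr o.2 (Option.some_injective _ h ▸ i.2)
  rw [MDP.Pr_singleton_of_terminal_succ hne (shortcut_terminal_succ hWF i),
    Finset.sum_congr rfl fun a _ => hterm a]
  rw [Finset.sum_congr rfl fun a _ => hterm a]
  refine Finset.sum_nonneg fun a _ => mul_nonneg (hnn a) ?_
  obtain ⟨k, hk⟩ := a.2
  exact (hB k _ hk).1 o

/-- The points achievable in a shortcut oMDP lie below the convex hull of the family,
or below `0` where the family is empty. -/
theorem pullExit_shortcut_mem [Fintype S] [Fintype A] (hWF : 𝒜.WF)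
    (hB : ∀ k, ∀ p ∈ B k, Subdist p)
    (hmem : ∀ s ∈ 𝒜.exit, (some s : Option S) ∈ (𝒜.shortcut B).exit) (i : 𝒜.EntrIdx)
    {p : (𝒜.shortcut B).ExitIdx → ℝ} (hp : p ∈ (𝒜.shortcut B).achievable (some i.1)) :
    pullExit 𝒜 (𝒜.shortcut B) some hmem p ≤ 0 ∨
      pullExit 𝒜 (𝒜.shortcut B) some hmem p ∈ dwConv (B i : Set (𝒜.ExitIdx → ℝ)) := by
  obtain ⟨σ, hσ, hle⟩ := hp
  obtain ⟨hnn, hen, hsum⟩ := hσ ⟨some i.1, []⟩ trivial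
  have hsupp (a) (ha : σ ⟨some i.1, []⟩ a ≠ 0) : a.1 ∈ B i :=
    (shortcut_enabled_iff 𝒜 B i a).1 (hen a ha)
  have hle' (o : 𝒜.ExitIdx) : pullExit 𝒜 (𝒜.shortcut B) some hmem p o ≤
      ∑ a, σ ⟨some i.1, []⟩ a * a.1 o :=
    (hle ⟨some o.1, hmem o.1 o.2⟩).trans_eq (shortcut_Pr hWF hB i hnn hsupp o)
  by_cases ht : (𝒜.shortcut B).M.terminal (some i.1)
  · have hz (a) : σ ⟨some i.1, []⟩ a = 0 := by
      by_contra ha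
      exact hen a ha (ht a)
    exact .inl fun o => by simpa [hz] using hle' o
  · refine .inr ⟨∑ a, σ ⟨some i.1, []⟩ a • a.1, ?_, fun o => ?_⟩
    · rw [← Finset.sum_filter_of_ne (p := fun a => σ ⟨some i.1, []⟩ a ≠ 0)
        fun a _ h h0 => h (by simp [h0])]
      refine (convex_convexHull ℝ _).sum_mem (fun a _ => hnn a) ?_ fun a ha =>
        subset_convexHull ℝ _ (hsupp a (Finset.mem_filter.1 ha).2)
      rw [Finset.sum_filter_ne_zero]
      exact hsum ht
    · simpa using hle' o

theorem exists_pullExit_shortcut [Fintype S] [Fintype A] (hWF : 𝒜.WF)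
    (hB : ∀ k, ∀ p ∈ B k, Subdist p)
    (hmem : ∀ s ∈ 𝒜.exit, (some s : Option S) ∈ (𝒜.shortcut B).exit) (i : 𝒜.EntrIdx)
    {p : 𝒜.ExitIdx → ℝ} (hp : p ∈ dwConv (B i : Set (𝒜.ExitIdx → ℝ))) :
    p ∈ pullExit 𝒜 (𝒜.shortcut B) some hmem '' (𝒜.shortcut B).achievable (some i.1) := by
  obtain ⟨q, hq, hpq⟩ := hp
  obtain ⟨w, hw0, hw1, hwq⟩ := Finset.mem_convexHull'.1 hq
  let σ : Sched (Option S) (ShortAct 𝒜 B) := fun π a =>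
    if π.last = some i.1 then if a.1 ∈ B i then w a.1 else 0
    else (𝒜.shortcut B).M.anySched π a
  have hmix (f : (𝒜.ExitIdx → ℝ) → ℝ) :
      ∑ a : ShortAct 𝒜 B, (if a.1 ∈ B i then f a.1 else 0) = ∑ x ∈ B i, f x := by
    rw [← Finset.sum_filter]
    refine Finset.sum_bij (fun a _ => a.1) (fun a ha => (Finset.mem_filter.1 ha).2)
      (fun a _ b _ h => Subtype.ext h)
      (fun x hx => ⟨⟨x, i, hx⟩, by simpa using hx, rfl⟩) fun a _ => rfl
  have hσ : (𝒜.shortcut B).M.IsSched σ := by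
    intro π hπ
    by_cases hl : π.last = some i.1
    · have hσπ : σ π = fun a => if a.1 ∈ B i then w a.1 else 0 := by
        funext a; simp [σ, hl]
      rw [hσπ]
      refine ⟨fun a => ?_, fun a ha => ?_, fun _ => (hmix w).trans hw1⟩
      · dsimp only
        split_ifs with h
        · exact hw0 _ h
        · exact le_rfl
      · rw [hl]
        refine (shortcut_enabled_iff 𝒜 B i a).2 ?_
        by_contra h
        simp [h] at ha
    · have hσπ : σ π = (𝒜.shortcut B).M.anySched π := by
        funext a; simp [σ, hl]
      rw [hσπ]
      exact (𝒜.shortcut B).M.isSched_anySched π hπ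
  have hσi (a) : σ ⟨some i.1, []⟩ a = if a.1 ∈ B i then w a.1 else 0 := by
    simp [σ, FinPath.last]
  obtain ⟨hnn, hen, -⟩ := hσ ⟨some i.1, []⟩ trivial
  let f : 𝒜.ExitIdx → (𝒜.shortcut B).ExitIdx := fun o => ⟨some o.1, hmem o.1 o.2⟩
  have hf : Function.Injective f := fun o o' h =>
    Subtype.ext (Option.some_injective _ (congrArg Subtype.val h))
  refine ⟨Function.extend f p 0, ⟨σ, hσ, ?_⟩, funext fun o => hf.extend_apply p 0 o⟩
  rintro ⟨t, ht⟩
  obtain ⟨s, hs, rfl⟩ : ∃ s ∈ 𝒜.exit, some s = t := by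
    simpa [exit, shortcut, or_and_right, exists_or] using ht
  refine (hf.extend_apply p 0 ⟨s, hs⟩).trans_le ((hpq ⟨s, hs⟩).trans_eq ?_)
  refine .trans ?_ (shortcut_Pr hWF hB i hnn
    (fun a ha => (shortcut_enabled_iff 𝒜 B i a).1 (hen a ha)) ⟨s, hs⟩).symm
  simp only [hσi, ite_mul, zero_mul]
  rw [hmix fun x => w x * x ⟨s, hs⟩, ← hwq]
  simp

end Shortcut

end OMDP

end SD

open SD in
/-- For every open MDP `𝒜`, every entrance `i` of `𝒜`, and every
sound approximation `(L,U)` of `𝒜` (families of convex, downward-closed,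
finitely generated sets, given by their vertex-families `VL`, `VU` of
subdistributions, with `L_i ⊆ A^𝒜(i) ⊆ U_i`):
`A^{D(L)}(i) ⊆ A^𝒜(i) ⊆ A^{D(U)}(i)`, where the achievable sets of the
shortcut oMDPs are transported along the canonical identification
`s ↦ some s` of the exits. -/
theorem statement_1 {S A : Type} [Fintype S] [Fintype A]
    (𝒜 : OMDP S A) (hWF : 𝒜.WF)
    (VL VU : 𝒜.EntrIdx → Finset (𝒜.ExitIdx → ℝ))
    (hVL : ∀ k, ∀ p ∈ VL k, Subdist p) (hVU : ∀ k, ∀ p ∈ VU k, Subdist p)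
    (L U : 𝒜.EntrIdx → Set (𝒜.ExitIdx → ℝ))
    (hLgen : ∀ k, L k = dwConv ((VL k : Finset (𝒜.ExitIdx → ℝ)) : Set (𝒜.ExitIdx → ℝ)))
    (hUgen : ∀ k, U k = dwConv ((VU k : Finset (𝒜.ExitIdx → ℝ)) : Set (𝒜.ExitIdx → ℝ)))
    (hsound : ∀ k : 𝒜.EntrIdx, L k ⊆ 𝒜.achievable k.1 ∧ 𝒜.achievable k.1 ⊆ U k)
    (hmemL : ∀ s ∈ 𝒜.exit, (some s : Option S) ∈ (𝒜.shortcut VL).exit)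
    (hmemU : ∀ s ∈ 𝒜.exit, (some s : Option S) ∈ (𝒜.shortcut VU).exit)
    (i : 𝒜.EntrIdx) :
    pullExit 𝒜 (𝒜.shortcut VL) some hmemL '' (𝒜.shortcut VL).achievable (some i.1) ⊆
        𝒜.achievable i.1 ∧
      𝒜.achievable i.1 ⊆
        pullExit 𝒜 (𝒜.shortcut VU) some hmemU '' (𝒜.shortcut VU).achievable (some i.1) := by
  refine ⟨?_, fun p hp =>
    OMDP.exists_pullExit_shortcut hWF hVU hmemU i (hUgen i ▸ (hsound i).2 hp)⟩
  rintro _ ⟨p, hp, rfl⟩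
  obtain h | h := OMDP.pullExit_shortcut_mem hWF hVL hmemL i hp
  · obtain ⟨σ, hσ, h0⟩ := OMDP.zero_mem_achievable hWF.1 i.1
    exact ⟨σ, hσ, h.trans h0⟩
  · exact (hsound i).1 (hLgen i ▸ h)
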